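/- arXiv:2012.14633 — 2 statements merged into one kernel-verified Lean document; each statement's English description precedes it below -/
import Mathlib

section
/- The closure of the convex hull of X equals the set of (x,y,t) ∈ [0,1]^N × ℝ₊^N × ℝ such that: for every S⁺ ⊆ N⁺, sup_{α ∈ B⁺} [ −m_α(S⁺)²/4 − Σ_{i ∈ N⁺\S⁺} max(α_i² − m_α(S⁺)², 0)·x_i/4 + Σ_{i∈N} α_i y_i ] ≤ t, and for every S⁻ ⊆ N⁻, sup_{α ∈ B⁻} [ −m_α(S⁻)²/4 − Σ_{i ∈ N⁻\S⁻} max(α_i² − m_α(S⁻)², 0)·x_i/4 + Σ_{i∈N} α_i y_i ] ≤ t, where m_α(S) = max_{i∈S} α_i with the convention m_α(∅) = 0. -/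
open Finset

noncomputable section

variable {ι : Type*}

/-- `m_α(S) = max_{i ∈ S} α_i` with the convention `m_α(∅) = 0`
(folding `max` starting at `0`; this agrees with the paper's convention since the
relevant coefficients are nonnegative on the sets where it is applied). -/
def mAlpha (α : ι → ℝ) (S : Finset ι) : ℝ := S.fold max 0 α

/-- The rank-one set `X` associated with the partition `N = N⁺ ∪ N⁻`. -/
def XSet [Fintype ι] (Np Nm : Finset ι) : Set ((ι → ℝ) × (ι → ℝ) × ℝ) :=
  {p | (∀ i, p.1 i = 0 ∨ p.1 i = 1) ∧ (∀ i, 0 ≤ p.2.1 i) ∧ 0 ≤ p.2.2 ∧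
       ((∑ i ∈ Np, p.2.1 i) - (∑ i ∈ Nm, p.2.1 i)) ^ 2 ≤ p.2.2 ∧
       ∀ i, p.2.1 i * (1 - p.1 i) = 0}

/-- `B⁺ = {α : α ≥ 0 on N⁺, α ≤ 0 on N⁻, α_i + α_j ≤ 0 ∀ i ∈ N⁺, j ∈ N⁻}`. -/
def BPlus (Np Nm : Finset ι) : Set (ι → ℝ) :=
  {α | (∀ i ∈ Np, 0 ≤ α i) ∧ (∀ j ∈ Nm, α j ≤ 0) ∧ ∀ i ∈ Np, ∀ j ∈ Nm, α i + α j ≤ 0}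

/-- The lifted supermodular expression for `α` and `S ⊆ A` (with `A = N⁺` or `N⁻`),
evaluated at `(x,y)`. -/
def liftExpr [Fintype ι] [DecidableEq ι] (A : Finset ι) (α : ι → ℝ) (S : Finset ι) (x y : ι → ℝ) : ℝ :=
  -(mAlpha α S) ^ 2 / 4
    - (∑ i ∈ A \ S, max ((α i) ^ 2 - (mAlpha α S) ^ 2) 0 * x i / 4)
    + ∑ i, α i * y i

lemma mAlpha_le {α : ι → ℝ} {S : Finset ι} {c : ℝ} (hc : 0 ≤ c) (h : ∀ i ∈ S, α i ≤ c) :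
    mAlpha α S ≤ c :=
  Finset.fold_max_le c |>.2 ⟨hc, h⟩

lemma mAlpha_nonneg (α : ι → ℝ) (S : Finset ι) : 0 ≤ mAlpha α S :=
  Finset.le_fold_max 0 |>.2 (Or.inl le_rfl)

lemma le_mAlpha {α : ι → ℝ} {S : Finset ι} {i : ι} (hi : i ∈ S) : α i ≤ mAlpha α S :=
  Finset.le_fold_max _ |>.2 (Or.inr ⟨i, hi, le_rfl⟩)

lemma XSet_comm [Fintype ι] (A B : Finset ι) : XSet A B = XSet B A := by
  unfold XSet
  ext p
  simp only [Set.mem_ofPred_eq]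
  rw [← neg_sub, neg_sq]

/-- The quadratic bound behind the validity of the lifted inequalities. -/
lemma sum_mul_le_of_dominated [Fintype ι] [DecidableEq ι] {A B : Finset ι}
    (hdisj : Disjoint A B) (hunion : A ∪ B = Finset.univ) {α y : ι → ℝ} {a t : ℝ}
    (hA : ∀ i ∈ A, α i * y i ≤ a * y i) (hB : ∀ j ∈ B, α j * y j ≤ -a * y j)
    (ht : ((∑ i ∈ A, y i) - ∑ i ∈ B, y i) ^ 2 ≤ t) :
    ∑ i, α i * y i ≤ t + a ^ 2 / 4 := by
  rw [← hunion, Finset.sum_union hdisj]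
  have h1 := Finset.sum_le_sum hA
  have h2 := Finset.sum_le_sum hB
  rw [← Finset.mul_sum] at h1 h2
  nlinarith [sq_nonneg ((∑ i ∈ A, y i) - (∑ i ∈ B, y i) - a / 2)]

/-- The lifted supermodular inequalities are valid for `XSet`. -/
lemma liftExpr_le_of_mem_XSet [Fintype ι] [DecidableEq ι] {A B : Finset ι}
    (hdisj : Disjoint A B) (hunion : A ∪ B = Finset.univ) {α : ι → ℝ} (hα : α ∈ BPlus A B)
    (S : Finset ι) {p : (ι → ℝ) × (ι → ℝ) × ℝ} (hp : p ∈ XSet A B) :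
    liftExpr A α S p.1 p.2.1 ≤ p.2.2 := by
  obtain ⟨hx, hy, -, hs, hxy⟩ := hp
  obtain ⟨hαA, hαB, hαAB⟩ := hα
  set m := mAlpha α S with hm
  have hx0 : ∀ i, 0 ≤ p.1 i := fun i => by rcases hx i with h | h <;> simp [h]
  have hterm : ∀ i ∈ A \ S, 0 ≤ max ((α i) ^ 2 - m ^ 2) 0 * p.1 i / 4 := fun i _ =>
    div_nonneg (mul_nonneg (le_max_right _ _) (hx0 i)) (by norm_num)
  obtain ⟨a, haA, haB, hbound⟩ : ∃ a : ℝ, (∀ i ∈ A, p.1 i = 1 → α i ≤ a) ∧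
      (∀ j ∈ B, α j ≤ -a) ∧
      a ^ 2 / 4 ≤ m ^ 2 / 4 + ∑ i ∈ A \ S, max ((α i) ^ 2 - m ^ 2) 0 * p.1 i / 4 := by
    by_cases hT : (A.filter fun i => p.1 i = 1).Nonempty
    · obtain ⟨k, hk, hmax⟩ := Finset.exists_max_image _ α hT
      rw [Finset.mem_filter] at hk
      refine ⟨α k, fun i hi h => hmax i (by simp [hi, h]),
        fun j hj => by linarith [hαAB k hk.1 j hj], ?_⟩
      by_cases hkS : k ∈ S
      · have h1 : α k ≤ m := le_mAlpha hkS
        have h2 := Finset.sum_nonneg hterm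
        have h3 := pow_le_pow_left₀ (hαA k hk.1) h1 2
        linarith
      · have h1 := Finset.single_le_sum hterm (Finset.mem_sdiff.2 ⟨hk.1, hkS⟩)
        rw [hk.2] at h1
        linarith [le_max_left ((α k) ^ 2 - m ^ 2) 0]
    · refine ⟨0, fun i hi h => (hT ⟨i, by simp [hi, h]⟩).elim, by simpa using hαB, ?_⟩
      have h2 := Finset.sum_nonneg hterm
      nlinarith [sq_nonneg m]
  have key := sum_mul_le_of_dominated hdisj hunion (α := α) (a := a)
    (fun i hi => by
      rcases hx i with h | h
      · have := hxy i
        rw [h] at this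
        have : p.2.1 i = 0 := by linarith
        simp [this]
      · exact mul_le_mul_of_nonneg_right (haA i hi h) (hy i))
    (fun j hj => mul_le_mul_of_nonneg_right (haB j hj) (hy j)) hs
  unfold liftExpr
  rw [← hm]
  linarith

lemma liftExpr_add_smul [Fintype ι] [DecidableEq ι] (A : Finset ι) (α : ι → ℝ) (S : Finset ι)
    (x y x' y' : ι → ℝ) {a b : ℝ} (hab : a + b = 1) :
    liftExpr A α S (a • x + b • x') (a • y + b • y') =
      a * liftExpr A α S x y + b * liftExpr A α S x' y' := by
  have h1 : ∑ i ∈ A \ S, max ((α i) ^ 2 - (mAlpha α S) ^ 2) 0 * (a • x + b • x') i / 4 =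
      a * (∑ i ∈ A \ S, max ((α i) ^ 2 - (mAlpha α S) ^ 2) 0 * x i / 4) +
      b * (∑ i ∈ A \ S, max ((α i) ^ 2 - (mAlpha α S) ^ 2) 0 * x' i / 4) := by
    rw [Finset.mul_sum, Finset.mul_sum, ← Finset.sum_add_distrib]
    refine Finset.sum_congr rfl fun i _ => ?_
    simp only [Pi.add_apply, Pi.smul_apply, smul_eq_mul]
    ring
  have h2 : ∑ i, α i * (a • y + b • y') i =
      a * (∑ i, α i * y i) + b * (∑ i, α i * y' i) := by
    rw [Finset.mul_sum, Finset.mul_sum, ← Finset.sum_add_distrib]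
    refine Finset.sum_congr rfl fun i _ => ?_
    simp only [Pi.add_apply, Pi.smul_apply, smul_eq_mul]
    ring
  unfold liftExpr
  rw [h1, h2]
  linear_combination (-(mAlpha α S) ^ 2 / 4) * (-hab)

lemma isClosed_liftExpr_le [Fintype ι] [DecidableEq ι] (A : Finset ι) (α : ι → ℝ)
    (S : Finset ι) :
    IsClosed {p : (ι → ℝ) × (ι → ℝ) × ℝ | liftExpr A α S p.1 p.2.1 ≤ p.2.2} := by
  unfold liftExpr
  exact isClosed_le (by fun_prop) (by fun_prop)

lemma convex_liftExpr_le [Fintype ι] [DecidableEq ι] (A : Finset ι) (α : ι → ℝ)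
    (S : Finset ι) :
    Convex ℝ {p : (ι → ℝ) × (ι → ℝ) × ℝ | liftExpr A α S p.1 p.2.1 ≤ p.2.2} := by
  intro p hp q hq a b ha hb hab
  simp only [Set.mem_ofPred_eq, Prod.fst_add, Prod.snd_add, Prod.smul_fst, Prod.smul_snd,
    smul_eq_mul] at *
  rw [liftExpr_add_smul _ _ _ _ _ _ _ hab]
  exact add_le_add (mul_le_mul_of_nonneg_left hp ha) (mul_le_mul_of_nonneg_left hq hb)

/-- A linear inequality valid on `XSet` is valid on its closed convex hull. -/
lemma liftExpr_le_of_mem_closure [Fintype ι] [DecidableEq ι] {A B : Finset ι}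
    (hdisj : Disjoint A B) (hunion : A ∪ B = Finset.univ) {α : ι → ℝ} (hα : α ∈ BPlus A B)
    (S : Finset ι) {p : (ι → ℝ) × (ι → ℝ) × ℝ} (hp : p ∈ closure (convexHull ℝ (XSet A B))) :
    liftExpr A α S p.1 p.2.1 ≤ p.2.2 :=
  closure_minimal (convexHull_min (fun _ hq => liftExpr_le_of_mem_XSet hdisj hunion hα S hq)
    (convex_liftExpr_le A α S)) (isClosed_liftExpr_le A α S) hp

lemma mem_box_of_mem_closure [Fintype ι] {A B : Finset ι} {p : (ι → ℝ) × (ι → ℝ) × ℝ}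
    (hp : p ∈ closure (convexHull ℝ (XSet A B))) :
    (∀ i, 0 ≤ p.1 i ∧ p.1 i ≤ 1) ∧ ∀ i, 0 ≤ p.2.1 i := by
  have hsub : closure (convexHull ℝ (XSet A B)) ⊆
      Set.Icc (0 : ι → ℝ) 1 ×ˢ (Set.Ici (0 : ι → ℝ) ×ˢ (Set.univ : Set ℝ)) := by
    refine closure_minimal (convexHull_min ?_ ?_) ?_
    · rintro q ⟨hx, hy, -⟩
      refine ⟨⟨fun i => ?_, fun i => ?_⟩, fun i => hy i, trivial⟩
      · rcases hx i with h | h <;> simp [h]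
      · rcases hx i with h | h <;> simp [h]
    · exact (convex_Icc _ _).prod ((convex_Ici _).prod convex_univ)
    · exact isClosed_Icc.prod (isClosed_Ici.prod isClosed_univ)
  obtain ⟨⟨h0, h1⟩, hy, -⟩ := hsub hp
  exact ⟨fun i => ⟨h0 i, h1 i⟩, hy⟩

/-- The convex piecewise linear function `M ↦ M + ∑ (α_i² / 4 - M)⁺ x_i` on `[0, ∞)` attains its
minimum at `0` or at a breakpoint. -/
lemma exists_subset_breakpoint_le [DecidableEq ι] (A : Finset ι) {α x : ι → ℝ}
    (hα : ∀ i ∈ A, 0 ≤ α i) {M : ℝ} (hM : 0 ≤ M) :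
    ∃ S ⊆ A, (mAlpha α S) ^ 2 / 4 +
        ∑ i ∈ A \ S, max ((α i) ^ 2 - (mAlpha α S) ^ 2) 0 * x i / 4 ≤
      M + ∑ i ∈ A, max ((α i) ^ 2 / 4 - M) 0 * x i := by
  set S := A.filter fun i => (α i) ^ 2 / 4 ≤ M with hS
  have hSA : S ⊆ A := Finset.filter_subset _ _
  have hmem : ∀ i ∈ A \ S, i ∈ A ∧ M < (α i) ^ 2 / 4 := fun i hi => by
    simp only [hS, Finset.mem_sdiff, Finset.mem_filter, not_and, not_le] at hi
    exact ⟨hi.1, hi.2 hi.1⟩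
  have hlevel : (mAlpha α S) ^ 2 / 4 ≤ M := by
    have h : mAlpha α S ≤ 2 * √M := mAlpha_le (by positivity) fun i hi => by
      have := (Finset.mem_filter.1 hi).2
      have := Real.le_sqrt_of_sq_le (x := α i / 2) (y := M) (by linarith)
      linarith
    have h2 := pow_le_pow_left₀ (mAlpha_nonneg α S) h 2
    rw [mul_pow, Real.sq_sqrt hM] at h2
    linarith
  have hrhs : ∑ i ∈ A, max ((α i) ^ 2 / 4 - M) 0 * x i =
      (∑ i ∈ A \ S, (α i) ^ 2 / 4 * x i) - M * ∑ i ∈ A \ S, x i := by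
    rw [← Finset.sum_sdiff hSA, Finset.mul_sum, ← Finset.sum_sub_distrib]
    have h0 : ∑ i ∈ S, max ((α i) ^ 2 / 4 - M) 0 * x i = 0 :=
      Finset.sum_eq_zero fun i hi => by
        rw [max_eq_right (by linarith [(Finset.mem_filter.1 hi).2]), zero_mul]
    rw [h0, add_zero]
    refine Finset.sum_congr rfl fun i hi => ?_
    rw [max_eq_left (by linarith [(hmem i hi).2])]
    ring
  have hlhs : ∀ m : ℝ, (∀ i ∈ A \ S, m ^ 2 ≤ (α i) ^ 2) →
      ∑ i ∈ A \ S, max ((α i) ^ 2 - m ^ 2) 0 * x i / 4 =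
        (∑ i ∈ A \ S, (α i) ^ 2 / 4 * x i) - m ^ 2 / 4 * ∑ i ∈ A \ S, x i := fun m hm => by
    rw [Finset.mul_sum, ← Finset.sum_sub_distrib]
    refine Finset.sum_congr rfl fun i hi => ?_
    rw [max_eq_left (by linarith [hm i hi])]
    ring
  rw [hrhs]
  by_cases hX : ∑ i ∈ A \ S, x i ≤ 1
  · refine ⟨S, hSA, ?_⟩
    rw [hlhs _ fun i hi => by linarith [(hmem i hi).2]]
    nlinarith
  · have hne : (A \ S).Nonempty := by
      by_contra h
      rw [Finset.not_nonempty_iff_eq_empty] at h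
      simp [h] at hX
    obtain ⟨k, hk, hmin⟩ := Finset.exists_min_image _ α hne
    have hkA := (hmem k hk).1
    have hm : mAlpha α (insert k S) = α k := by
      refine le_antisymm (mAlpha_le (hα k hkA) fun i hi => ?_)
        (le_mAlpha (Finset.mem_insert_self _ _))
      rcases Finset.mem_insert.1 hi with rfl | hi
      · exact le_rfl
      · refine le_of_sq_le_sq ?_ (hα k hkA)
        linarith [(Finset.mem_filter.1 hi).2, (hmem k hk).2]
    refine ⟨insert k S, Finset.insert_subset hkA hSA, ?_⟩
    have hsum : ∑ i ∈ A \ insert k S, max ((α i) ^ 2 - (α k) ^ 2) 0 * x i / 4 =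
        ∑ i ∈ A \ S, max ((α i) ^ 2 - (α k) ^ 2) 0 * x i / 4 := by
      rw [Finset.sdiff_insert]
      exact Finset.sum_erase _ (by simp)
    rw [hm, hsum, hlhs _ fun i hi => pow_le_pow_left₀ (hα k hkA) (hmin i hi) 2]
    nlinarith [(hmem k hk).2]

/-- Coefficients of an upper bound on `XSet` satisfy the sign conditions across the partition. -/
lemma add_nonpos_of_valid [Fintype ι] [DecidableEq ι] {A B : Finset ι}
    (hdisj : Disjoint A B) {α β : ι → ℝ} {u : ℝ}
    (h : ∀ p ∈ XSet A B, ∑ i, α i * p.2.1 i + ∑ i, β i * p.1 i - p.2.2 ≤ u)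
    {i j : ι} (hi : i ∈ A) (hj : j ∈ B) : α i + α j ≤ 0 := by
  have hiB : i ∉ B := Finset.disjoint_left.1 hdisj hi
  have hjA : j ∉ A := Finset.disjoint_right.1 hdisj hj
  by_contra! hpos
  have hray : ∀ r : ℝ, 0 ≤ r → r * (α i + α j) + ∑ i, β i ≤ u := fun r hr => by
    have := h (1, Pi.single i r + Pi.single j r, 0) ⟨fun _ => Or.inr rfl, fun k => by
      have h1 : (0 : ι → ℝ) ≤ Pi.single i r := Pi.single_nonneg.2 hr
      have h2 : (0 : ι → ℝ) ≤ Pi.single j r := Pi.single_nonneg.2 hr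
      exact add_nonneg (h1 k) (h2 k), le_rfl, by
        simp [Finset.sum_add_distrib, hi, hj, hiB, hjA], by simp⟩
    simp [mul_add, Finset.sum_add_distrib, Pi.single_apply] at this
    linarith
  have h0 := hray 0 le_rfl
  have h1 := hray ((u - ∑ i, β i + 1) / (α i + α j)) (div_nonneg (by linarith) hpos.le)
  rw [div_mul_cancel₀ _ hpos.ne'] at h1
  linarith

/-- Every upper bound on `XSet` whose coefficients are nonpositive on `B` is dominated by a
lifted supermodular inequality. -/
lemma exists_liftExpr_ge [Fintype ι] [DecidableEq ι] {A B : Finset ι}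
    (hdisj : Disjoint A B) {α β : ι → ℝ} {u : ℝ}
    (h : ∀ p ∈ XSet A B, ∑ i, α i * p.2.1 i + ∑ i, β i * p.1 i - p.2.2 ≤ u)
    (hB : ∀ j ∈ B, α j ≤ 0) {x y : ι → ℝ} (hx : ∀ i, 0 ≤ x i ∧ x i ≤ 1) (hy : ∀ i, 0 ≤ y i) :
    ∃ α' ∈ BPlus A B, ∃ S ⊆ A,
      ∑ i, α i * y i + ∑ i, β i * x i - u ≤ liftExpr A α' S x y := by
  set α' : ι → ℝ := fun i => if i ∈ A then max (α i) 0 else α i with hα'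
  have hA' : ∀ i ∈ A, α' i = max (α i) 0 := fun i hi => by simp [hα', hi]
  have hB' : ∀ j ∈ B, α' j = α j := fun j hj => by
    simp [hα', Finset.disjoint_right.1 hdisj hj]
  have hle : ∀ i, α i ≤ α' i := fun i => by
    by_cases hi : i ∈ A <;> simp [hα', hi]
  have hpos : ∀ i ∈ A, 0 ≤ α' i := fun i hi => by rw [hA' i hi]; exact le_max_right _ _
  have hmem : α' ∈ BPlus A B := by
    refine ⟨hpos, fun j hj => by rw [hB' j hj]; exact hB j hj, fun i hi j hj => ?_⟩
    rw [hA' i hi, hB' j hj, max_add]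
    exact max_le (add_nonpos_of_valid hdisj h hi hj) (by linarith [hB j hj])
  have hM : 0 ≤ u - ∑ i, max (β i) 0 := by
    have := h (fun i => if 0 < β i then 1 else 0, 0, 0)
      ⟨fun i => by by_cases hi : 0 < β i <;> simp [hi], by simp, le_rfl, by simp, by simp⟩
    have heq : ∑ i, β i * (if 0 < β i then (1 : ℝ) else 0) = ∑ i, max (β i) 0 :=
      Finset.sum_congr rfl fun i _ => by
        by_cases hi : 0 < β i
        · simp [hi, hi.le]
        · simp [hi, not_lt.1 hi]
    simp only [Pi.zero_apply, mul_zero, Finset.sum_const_zero, heq] at this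
    linarith
  have hk : ∀ k ∈ A, (α' k) ^ 2 / 4 - (u - ∑ i, max (β i) 0) ≤ max (β k) 0 - β k := by
    intro k hkA
    have hkB : k ∉ B := Finset.disjoint_left.1 hdisj hkA
    have hsingle : (0 : ι → ℝ) ≤ Pi.single k (α' k / 2) :=
      Pi.single_nonneg.2 (by linarith [hpos k hkA])
    have := h (fun i => if i = k ∨ 0 < β i then 1 else 0, Pi.single k (α' k / 2), (α' k / 2) ^ 2)
      ⟨fun i => by by_cases hi : i = k ∨ 0 < β i <;> simp [hi], hsingle, sq_nonneg _, by
        simp [hkA, hkB], fun i => by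
        by_cases hi : i = k <;> simp [hi]⟩
    have heq : ∑ i, β i * (if i = k ∨ 0 < β i then (1 : ℝ) else 0) =
        ∑ i, max (β i) 0 + (β k - max (β k) 0) := by
      rw [← Finset.add_sum_erase _ _ (Finset.mem_univ k),
        ← Finset.add_sum_erase _ (fun i => max (β i) 0) (Finset.mem_univ k)]
      have : ∑ i ∈ Finset.univ.erase k, β i * (if i = k ∨ 0 < β i then (1 : ℝ) else 0) =
          ∑ i ∈ Finset.univ.erase k, max (β i) 0 :=
        Finset.sum_congr rfl fun i hi => by
          have hik := Finset.ne_of_mem_erase hi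
          by_cases hi : 0 < β i
          · simp [hi, hi.le]
          · simp [hi, not_lt.1 hi, hik]
      rw [this]
      simp
      ring
    have hy' : ∑ i, α i * (Pi.single k (α' k / 2) : ι → ℝ) i = α k * (α' k / 2) := by
      simp [Pi.single_apply]
    simp only [heq, hy'] at this
    have hsq : α k * α' k = α' k ^ 2 := by
      rw [hA' k hkA]
      rcases le_total (α k) 0 with h0 | h0 <;> simp [h0, sq]
    nlinarith
  obtain ⟨S, hSA, hS⟩ := exists_subset_breakpoint_le A (x := x) hpos hM
  refine ⟨α', hmem, S, hSA, ?_⟩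
  have h1 : ∑ i, α i * y i ≤ ∑ i, α' i * y i :=
    Finset.sum_le_sum fun i _ => mul_le_mul_of_nonneg_right (hle i) (hy i)
  have h2 : ∑ i ∈ A, max ((α' i) ^ 2 / 4 - (u - ∑ i, max (β i) 0)) 0 * x i ≤
      ∑ i, (max (β i) 0 - β i) * x i :=
    (Finset.sum_le_sum fun i hi => mul_le_mul_of_nonneg_right
      (max_le (hk i hi) (sub_nonneg.2 (le_max_left _ _))) (hx i).1).trans
      (Finset.sum_le_sum_of_subset_of_nonneg (Finset.subset_univ A) fun i _ _ =>
        mul_nonneg (sub_nonneg.2 (le_max_left _ _)) (hx i).1)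
  have h3 : ∑ i, (max (β i) 0 - β i) * x i ≤ ∑ i, max (β i) 0 - ∑ i, β i * x i := by
    rw [← Finset.sum_sub_distrib]
    refine Finset.sum_le_sum fun i _ => ?_
    nlinarith [le_max_right (β i) 0, (hx i).2]
  unfold liftExpr
  linarith

/-- A point outside the closed convex hull of `XSet` is separated from it by a functional whose
`t`-coefficient is `-1`. -/
lemma exists_separation_of_notMem_closure [Fintype ι] [DecidableEq ι] {A B : Finset ι}
    {p : (ι → ℝ) × (ι → ℝ) × ℝ} (hp : p ∉ closure (convexHull ℝ (XSet A B))) :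
    ∃ (α β : ι → ℝ) (u : ℝ),
      (∀ q ∈ XSet A B, ∑ i, α i * q.2.1 i + ∑ i, β i * q.1 i - q.2.2 ≤ u) ∧
      u < ∑ i, α i * p.2.1 i + ∑ i, β i * p.1 i - p.2.2 := by
  obtain ⟨f, u, hf, hu⟩ := geometric_hahn_banach_closed_point
    (convex_convexHull ℝ (XSet A B)).closure isClosed_closure hp
  have hfX : ∀ q ∈ XSet A B, f q ≤ u := fun q hq =>
    (hf q (subset_closure (subset_convexHull ℝ _ hq))).le
  obtain ⟨α, β, c, hrep⟩ : ∃ (α β : ι → ℝ) (c : ℝ), ∀ q : (ι → ℝ) × (ι → ℝ) × ℝ,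
      f q = ∑ i, α i * q.2.1 i + ∑ i, β i * q.1 i - c * q.2.2 := by
    refine ⟨fun i => f (0, Pi.single i 1, 0), fun i => f (Pi.single i 1, 0, 0),
      -f (0, 0, 1), fun q => ?_⟩
    have hq : q = ∑ i, q.2.1 i • ((0, Pi.single i 1, 0) : (ι → ℝ) × (ι → ℝ) × ℝ) +
        ∑ i, q.1 i • ((Pi.single i 1, 0, 0) : (ι → ℝ) × (ι → ℝ) × ℝ) +
        q.2.2 • ((0, 0, 1) : (ι → ℝ) × (ι → ℝ) × ℝ) := by
      refine Prod.ext ?_ (Prod.ext ?_ ?_)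
      · ext j
        simp [Prod.fst_sum, Finset.sum_apply, Pi.single_apply]
      · ext j
        simp [Prod.fst_sum, Prod.snd_sum, Finset.sum_apply, Pi.single_apply]
      · simp [Prod.snd_sum]
    conv_lhs => rw [hq]
    simp only [map_add, map_sum, map_smul, smul_eq_mul]
    simp only [mul_comm]
    ring
  have hc : 0 ≤ c := by
    by_contra! hc
    have hray : ∀ r : ℝ, 0 ≤ r → -c * r ≤ u := fun r hr => by
      have := hfX (0, 0, r) ⟨by simp, by simp, hr, by simpa using hr, by simp⟩
      rw [hrep] at this
      simp at this
      linarith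
    have h0 := hray 0 le_rfl
    have h1 := hray ((u + 1) / -c) (div_nonneg (by linarith) (by linarith))
    rw [mul_div_cancel₀ _ (by linarith)] at h1
    linarith
  obtain ⟨ε, hε, hεp⟩ : ∃ ε > 0, ε * p.2.2 < f p - u := by
    refine ⟨(f p - u) / (|p.2.2| + 1), div_pos (by linarith) (by positivity), ?_⟩
    rw [div_mul_eq_mul_div, div_lt_iff₀ (by positivity)]
    have := le_abs_self p.2.2
    nlinarith
  have hd : 0 < c + ε := by linarith
  have hscale : ∀ q : (ι → ℝ) × (ι → ℝ) × ℝ,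
      ∑ i, α i / (c + ε) * q.2.1 i + ∑ i, β i / (c + ε) * q.1 i - q.2.2 =
        (f q - ε * q.2.2) / (c + ε) := fun q => by
    rw [hrep, eq_div_iff hd.ne']
    simp only [div_mul_eq_mul_div, ← Finset.sum_div]
    field_simp
    ring
  refine ⟨fun i => α i / (c + ε), fun i => β i / (c + ε), u / (c + ε), fun q hq => ?_, ?_⟩
  · rw [hscale]
    refine div_le_div_of_nonneg_right ?_ hd.le
    linarith [hfX q hq, mul_nonneg hε.le hq.2.2.1]
  · rw [hscale]
    exact div_lt_div_of_pos_right (by linarith) hd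

/-- The closed convex hull of `X` equals the set of
`(x,y,t) ∈ [0,1]^N × ℝ₊^N × ℝ` satisfying all lifted supermodular inequalities
over `B⁺` (for `S⁺ ⊆ N⁺`) and over `B⁻` (for `S⁻ ⊆ N⁻`). -/
theorem stmt_13 [Fintype ι] [DecidableEq ι] (Np Nm : Finset ι)
    (hdisj : Disjoint Np Nm) (hunion : Np ∪ Nm = Finset.univ) :
    closure (convexHull ℝ (XSet Np Nm)) =
      {p : (ι → ℝ) × (ι → ℝ) × ℝ |
        (∀ i, 0 ≤ p.1 i ∧ p.1 i ≤ 1) ∧ (∀ i, 0 ≤ p.2.1 i) ∧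
        (∀ Sp : Finset ι, Sp ⊆ Np →
          (⨆ α ∈ BPlus Np Nm, ((liftExpr Np α Sp p.1 p.2.1 : ℝ) : EReal)) ≤
            ((p.2.2 : ℝ) : EReal)) ∧
        (∀ Sm : Finset ι, Sm ⊆ Nm →
          (⨆ α ∈ BPlus Nm Np, ((liftExpr Nm α Sm p.1 p.2.1 : ℝ) : EReal)) ≤
            ((p.2.2 : ℝ) : EReal))} := by
  ext p
  simp only [Set.mem_ofPred_eq, iSup_le_iff, EReal.coe_le_coe_iff]
  have hdisj' := hdisj.symm
  have hunion' : Nm ∪ Np = Finset.univ := by rw [Finset.union_comm, hunion]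
  constructor
  · intro hp
    obtain ⟨hx, hy⟩ := mem_box_of_mem_closure hp
    refine ⟨hx, hy, fun S _ α hα => liftExpr_le_of_mem_closure hdisj hunion hα S hp,
      fun S _ α hα => liftExpr_le_of_mem_closure hdisj' hunion' hα S ?_⟩
    rwa [XSet_comm]
  · rintro ⟨hx, hy, hplus, hminus⟩
    by_contra hp
    obtain ⟨α, β, u, hX, hu⟩ := exists_separation_of_notMem_closure hp
    by_cases hNm : ∀ j ∈ Nm, α j ≤ 0
    · obtain ⟨α', hα', S, hS, hle⟩ := exists_liftExpr_ge hdisj hX hNm hx hy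
      linarith [hplus S hS α' hα']
    · push Not at hNm
      obtain ⟨j, hj, hjpos⟩ := hNm
      have hNp : ∀ i ∈ Np, α i ≤ 0 := fun i hi => by
        linarith [add_nonpos_of_valid hdisj hX hi hj]
      rw [XSet_comm] at hX
      obtain ⟨α', hα', S, hS, hle⟩ := exists_liftExpr_ge hdisj' hX hNp hx hy
      linarith [hminus S hS α' hα']

end
end

section
/- Let N be a finite set and X₊ = {(x,y,t) ∈ {0,1}^N × ℝ₊^N × ℝ₊ : (Σ_{i∈N} y_i)² ≤ t and y_i(1−x_i) = 0 for all i ∈ N}. Then the closure of the convex hull of X₊ equals the set of (x,y,t) ∈ [0,1]^N × ℝ₊^N × ℝ such that for every partition (L,R) of N, σ_{L,R}(x,y) ≤ t, where σ_{L,R}(x,y) is the optimal value of: minimize y(L)²/(1−x(R)+μ(R)) + Σ_{i∈R} y_i²/(x_i−μ_i) over μ ∈ ℝ₊^R subject to 1−x(R)+μ(R) ≥ 0 and μ_i ≤ x_i for all i ∈ R. -/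
open Finset

noncomputable section

variable {ι : Type*}

/-- Extended-real ratio with the conventions `a/0 = +∞` for `a > 0` and `0/0 = 0`
(and `a/0 = −∞` for `a < 0`, which never occurs in the statements below). -/
def ratio (a b : ℝ) : EReal :=
  if b = 0 then (if 0 < a then (⊤ : EReal) else if a < 0 then (⊥ : EReal) else (0 : EReal))
  else ((a / b : ℝ) : EReal)

/-- `σ_{L,R}(x,y)`: the optimal value of the extended formulation for `X₊`:
minimize `y(L)²/(1−x(R)+μ(R)) + ∑_{i∈R} y_i²/(x_i−μ_i)` over `μ ∈ ℝ₊^R` subject to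
`1−x(R)+μ(R) ≥ 0` and `μ_i ≤ x_i` for all `i ∈ R`. -/
def sigmaX [Fintype ι] (L R : Finset ι) (x y : ι → ℝ) : EReal :=
  sInf {v : EReal | ∃ mu : ι → ℝ, (∀ i, 0 ≤ mu i) ∧
    0 ≤ 1 - (∑ i ∈ R, x i) + (∑ i ∈ R, mu i) ∧ (∀ i ∈ R, mu i ≤ x i) ∧
    v = ratio ((∑ i ∈ L, y i) ^ 2) (1 - (∑ i ∈ R, x i) + (∑ i ∈ R, mu i))
        + ∑ i ∈ R, ratio ((y i) ^ 2) (x i - mu i)}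

/-- The rank-one set `X₊ = {(x,y,t) ∈ {0,1}^N × ℝ₊^N × ℝ₊ : (∑ y_i)² ≤ t,
y_i(1−x_i) = 0 ∀i}`. -/
def XPlus [Fintype ι] : Set ((ι → ℝ) × (ι → ℝ) × ℝ) :=
  {p | (∀ i, p.1 i = 0 ∨ p.1 i = 1) ∧ (∀ i, 0 ≤ p.2.1 i) ∧ 0 ≤ p.2.2 ∧
       (∑ i, p.2.1 i) ^ 2 ≤ p.2.2 ∧ ∀ i, p.2.1 i * (1 - p.1 i) = 0}

/-- A second order conic description of the convex hull of `XPlus`: the weight `w i` is the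
fraction of the unit interval on which coordinate `i` carries its mass `y i`. -/
def conicHull [Fintype ι] : Set ((ι → ℝ) × (ι → ℝ) × ℝ) :=
  {p | (∀ i, 0 ≤ p.1 i ∧ p.1 i ≤ 1) ∧ (∀ i, 0 ≤ p.2.1 i) ∧
    ∃ w τ : ι → ℝ, (∀ i, 0 ≤ w i) ∧ (∀ i, w i ≤ p.1 i) ∧ ∑ i, w i ≤ 1 ∧ (∀ i, 0 ≤ τ i) ∧
      (∀ i, p.2.1 i ^ 2 ≤ τ i * w i) ∧ ∑ i, τ i ≤ p.2.2}

/-- The outer description of the convex hull of `XPlus` by linear inequalities. -/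
def linearHull [Fintype ι] : Set ((ι → ℝ) × (ι → ℝ) × ℝ) :=
  {p | (∀ i, 0 ≤ p.1 i ∧ p.1 i ≤ 1) ∧ (∀ i, 0 ≤ p.2.1 i) ∧
    ∀ (c : ℝ) (s : ι → ℝ), 0 ≤ c → (∀ i, c ≤ s i) →
      ∑ i, (2 * p.2.1 i * s i - (s i ^ 2 - c ^ 2) * p.1 i) - c ^ 2 ≤ p.2.2}

theorem ereal_coe_sum (s : Finset ι) (f : ι → ℝ) :
    ((∑ i ∈ s, f i : ℝ) : EReal) = ∑ i ∈ s, (f i : EReal) :=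
  map_sum (⟨⟨Real.toEReal, EReal.coe_zero⟩, EReal.coe_add⟩ : ℝ →+ EReal) f s

theorem ratio_le_of_le_mul {a b c : ℝ} (ha : 0 ≤ a) (hb : 0 ≤ b) (hc : 0 ≤ c)
    (h : a ≤ c * b) : ratio a b ≤ (c : EReal) := by
  unfold ratio
  split_ifs with h0 h1 h2
  · subst h0; linarith
  · linarith
  · exact_mod_cast hc
  · have hb' : 0 < b := lt_of_le_of_ne hb (Ne.symm h0)
    exact_mod_cast (div_le_iff₀ hb').2 h

theorem tangent_le_ratio (a s : ℝ) {b : ℝ} (hb : 0 ≤ b) :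
    ((2 * a * s - s ^ 2 * b : ℝ) : EReal) ≤ ratio (a ^ 2) b := by
  unfold ratio
  split_ifs with h0 h1 h2
  · exact le_top
  · exact absurd h2 (not_lt.2 (sq_nonneg a))
  · have ha : a = 0 := by
      have : a ^ 2 = 0 := le_antisymm (not_lt.1 h1) (sq_nonneg a)
      simpa using this
    subst ha; subst h0
    simp
  · have hb' : 0 < b := lt_of_le_of_ne hb (Ne.symm h0)
    have : 2 * a * s - s ^ 2 * b ≤ a ^ 2 / b := by
      rw [le_div_iff₀ hb']
      nlinarith [sq_nonneg (a - s * b)]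
    exact_mod_cast this

theorem xPlus_subset_conicHull [Fintype ι] : XPlus (ι := ι) ⊆ conicHull := by
  rintro ⟨x, y, t⟩ ⟨hx, hy, ht, hyt, hxy⟩
  dsimp only at *
  have hY : 0 ≤ ∑ i, y i := sum_nonneg fun i _ => hy i
  have hx01 : ∀ i, 0 ≤ x i ∧ x i ≤ 1 := fun i => by
    rcases hx i with h | h <;> rw [h] <;> norm_num
  have hle : ∀ i, y i ≤ ∑ j, y j := fun i =>
    single_le_sum (f := y) (fun j _ => hy j) (mem_univ i)
  refine ⟨hx01, hy, fun i => y i / ∑ j, y j, fun i => y i * ∑ j, y j,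
    fun i => div_nonneg (hy i) hY, fun i => ?_, ?_, fun i => mul_nonneg (hy i) hY,
    fun i => ?_, ?_⟩
  · dsimp only
    rcases hx i with h | h
    · have : y i = 0 := by simpa [h] using hxy i
      simp [h, this]
    · rw [h]
      exact div_le_one_of_le₀ (hle i) hY
  · rw [← sum_div]
    exact div_self_le_one _
  · dsimp only
    rcases hY.eq_or_lt with h | h
    · have : y i = 0 := le_antisymm (h ▸ hle i) (hy i)
      simp [this]
    · apply le_of_eq
      field_simp
  · rw [← sum_mul]
    nlinarith

theorem conicHull_subset_linearHull [Fintype ι] : conicHull (ι := ι) ⊆ linearHull := by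
  rintro ⟨x, y, t⟩ ⟨hx, hy, w, τ, hw, hwx, hw1, hτ, hyτ, hτt⟩
  refine ⟨hx, hy, fun c s hc hs => ?_⟩
  dsimp only at *
  have key : ∀ i, 2 * y i * s i - (s i ^ 2 - c ^ 2) * x i ≤ τ i + c ^ 2 * w i := by
    intro i
    have h1 : 0 ≤ s i ^ 2 - c ^ 2 := by nlinarith [hs i]
    have h2 : 2 * y i * s i ≤ τ i + s i ^ 2 * w i := by
      have hsi : 0 ≤ s i := hc.trans (hs i)
      refine abs_le_of_sq_le_sq' ?_ (add_nonneg (hτ i) (mul_nonneg (sq_nonneg _) (hw i))) |>.2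
      nlinarith [sq_nonneg (τ i - s i ^ 2 * w i), mul_le_mul_of_nonneg_left (hyτ i) (sq_nonneg (s i))]
    nlinarith [mul_le_mul_of_nonneg_left (hwx i) h1]
  have hsum := sum_le_sum fun i (_ : i ∈ univ) => key i
  rw [sum_add_distrib, ← mul_sum] at hsum
  nlinarith [mul_le_mul_of_nonneg_left hw1 (sq_nonneg c)]

theorem linearHull_eq_zero [Fintype ι] {x y : ι → ℝ} {t : ℝ}
    (h : (x, y, t) ∈ linearHull) {i : ι} (hi : x i = 0) : y i = 0 := by
  classical
  obtain ⟨-, hy, hlin⟩ := h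
  dsimp only at *
  by_contra hne
  have hpos : 0 < y i := lt_of_le_of_ne (hy i) (Ne.symm hne)
  have h0 := hlin 0 0 le_rfl fun _ => le_rfl
  have ht : 0 ≤ t := by simpa using h0
  have hM : 0 ≤ (t + 1) / y i := by positivity
  have h1 := hlin 0 (Pi.single i ((t + 1) / y i)) le_rfl fun j => by
    by_cases hj : j = i
    · subst hj; simpa using hM
    · simp [hj]
  rw [sum_eq_single i (fun j _ hj => by simp [hj]) (by simp)] at h1
  simp only [Pi.single_eq_same, hi] at h1
  have : y i * ((t + 1) / y i) = t + 1 := by field_simp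
  nlinarith

theorem linearHull_subset_conicHull [Fintype ι] : linearHull (ι := ι) ⊆ conicHull := by
  rintro ⟨x, y, t⟩ h
  have hxy : ∀ i, x i = 0 → y i = 0 := fun i hi => linearHull_eq_zero h hi
  obtain ⟨hx, hy, hlin⟩ := h
  dsimp only at *
  have hdiv : ∀ i, y i / x i * x i = y i := fun i => div_mul_cancel_of_imp (hxy i)
  have hdiv0 : ∀ i, 0 ≤ y i / x i := fun i => div_nonneg (hy i) (hx i).1
  by_cases hP : ∑ i, (if y i = 0 then 0 else x i) ≤ 1
  · refine ⟨hx, hy, fun i => if y i = 0 then 0 else x i, fun i => y i * (y i / x i),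
      fun i => ?_, fun i => ?_, hP, fun i => mul_nonneg (hy i) (hdiv0 i), fun i => ?_, ?_⟩
    · dsimp only
      split_ifs
      exacts [le_rfl, (hx i).1]
    · dsimp only
      split_ifs
      exacts [(hx i).1, le_rfl]
    · dsimp only
      split_ifs with h
      · simp [h]
      · rw [mul_assoc, hdiv, sq]
    · refine le_trans (le_of_eq ?_) (hlin 0 (fun i => y i / x i) le_rfl hdiv0)
      simp only [ne_eq, OfNat.ofNat_ne_zero, not_false_eq_true, zero_pow, sub_zero]
      refine sum_congr rfl fun i _ => ?_
      linear_combination (y i / x i) * hdiv i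
  · push Not at hP
    obtain ⟨θ, hθ0, hθ⟩ : ∃ θ : ℝ, 0 ≤ θ ∧ ∑ i, min (x i) (θ * y i) = 1 := by
      set B := ∑ i, x i / y i with hB
      have hB0 : 0 ≤ B := sum_nonneg fun i _ => div_nonneg (hx i).1 (hy i)
      have hcont : ContinuousOn (fun θ : ℝ => ∑ i, min (x i) (θ * y i)) (Set.Icc 0 B) := by
        fun_prop
      have hmem : (1 : ℝ) ∈ Set.Icc (∑ i, min (x i) (0 * y i)) (∑ i, min (x i) (B * y i)) := by
        constructor
        · have : ∀ i, min (x i) (0 * y i) = 0 := fun i => by simp [(hx i).1]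
          simp only [this, sum_const_zero, zero_le_one]
        · refine hP.le.trans (sum_le_sum fun i _ => ?_)
          split_ifs with h
          · simp [h, (hx i).1]
          · refine le_min le_rfl ?_
            have h1 : x i / y i ≤ B := single_le_sum (f := fun j => x j / y j)
              (fun j _ => div_nonneg (hx j).1 (hy j)) (mem_univ i)
            calc x i = x i / y i * y i := by field_simp
              _ ≤ B * y i := mul_le_mul_of_nonneg_right h1 (hy i)
      obtain ⟨θ, hθ, h⟩ := intermediate_value_Icc hB0 hcont hmem
      exact ⟨θ, hθ.1, h⟩
    have hθpos : 0 < θ := by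
      refine lt_of_le_of_ne hθ0 fun h => ?_
      subst h
      have : ∀ i, min (x i) (0 * y i) = 0 := fun i => by simp [(hx i).1]
      simp only [this, sum_const_zero] at hθ
      exact zero_ne_one hθ
    have hc : θ⁻¹ * θ = 1 := inv_mul_cancel₀ hθpos.ne'
    have hc0 : 0 < θ⁻¹ := inv_pos.2 hθpos
    set c := θ⁻¹
    set s : ι → ℝ := fun i => max c (y i / x i) with hs
    have hcs : ∀ i, c ≤ s i := fun i => le_max_left _ _
    have hs0 : ∀ i, 0 ≤ s i := fun i => hc0.le.trans (hcs i)
    have key : ∀ i, y i ≤ s i * min (x i) (θ * y i) ∧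
        c ^ 2 * min (x i) (θ * y i) ≤ y i * s i - (s i ^ 2 - c ^ 2) * x i := by
      intro i
      rcases le_total (x i) (θ * y i) with h | h
      · rw [min_eq_left h]
        have h1 : y i ≤ s i * x i := by
          calc y i = y i / x i * x i := (hdiv i).symm
            _ ≤ s i * x i := mul_le_mul_of_nonneg_right (le_max_right _ _) (hx i).1
        have h2 : s i * x i ≤ y i := by
          rw [hs]
          dsimp only
          rw [max_mul_of_nonneg _ _ (hx i).1, hdiv]
          refine max_le ?_ le_rfl
          calc c * x i ≤ c * (θ * y i) := mul_le_mul_of_nonneg_left h hc0.le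
            _ = y i := by rw [← mul_assoc, hc, one_mul]
        refine ⟨h1, ?_⟩
        nlinarith [mul_le_mul_of_nonneg_left h2 (hs0 i)]
      · rw [min_eq_right h]
        have h1 : s i = c := by
          refine max_eq_left ?_
          rcases (hx i).1.eq_or_lt with h0 | h0
          · rw [← h0, div_zero]; exact hc0.le
          · rw [div_le_iff₀ h0]
            calc y i = c * (θ * y i) := by rw [← mul_assoc, hc, one_mul]
              _ ≤ c * x i := mul_le_mul_of_nonneg_left h hc0.le
        rw [h1]
        refine ⟨le_of_eq ?_, le_of_eq ?_⟩
        · linear_combination (-y i) * hc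
        · linear_combination (c * y i) * hc
    refine ⟨hx, hy, fun i => min (x i) (θ * y i), fun i => y i * s i,
      fun i => le_min (hx i).1 (mul_nonneg hθ0 (hy i)), fun i => min_le_left _ _, hθ.le,
      fun i => mul_nonneg (hy i) (hs0 i), fun i => ?_, ?_⟩
    · dsimp only
      nlinarith [mul_le_mul_of_nonneg_left (key i).1 (hy i)]
    · have hsum := sum_le_sum fun i (_ : i ∈ univ) => (key i).2
      rw [← mul_sum, hθ] at hsum
      have hl := hlin c s hc0.le hcs
      have : ∑ i, (2 * y i * s i - (s i ^ 2 - c ^ 2) * x i) =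
          ∑ i, y i * s i + ∑ i, (y i * s i - (s i ^ 2 - c ^ 2) * x i) := by
        rw [← sum_add_distrib]
        exact sum_congr rfl fun i _ => by ring
      dsimp only
      linarith

theorem convex_linearHull [Fintype ι] : Convex ℝ (linearHull (ι := ι)) := by
  rintro ⟨x, y, t⟩ ⟨hx, hy, h⟩ ⟨x', y', t'⟩ ⟨hx', hy', h'⟩ a b ha hb hab
  dsimp only at *
  refine ⟨fun i => ⟨?_, ?_⟩, fun i => ?_, fun c s hc hs => ?_⟩
  · simp only [Prod.fst_add, Prod.smul_fst, Pi.add_apply, Pi.smul_apply, smul_eq_mul]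
    nlinarith [hx i, hx' i]
  · simp only [Prod.fst_add, Prod.smul_fst, Pi.add_apply, Pi.smul_apply, smul_eq_mul]
    nlinarith [hx i, hx' i]
  · simp only [Prod.snd_add, Prod.fst_add, Prod.smul_fst, Prod.smul_snd, Pi.add_apply,
      Pi.smul_apply, smul_eq_mul]
    nlinarith [hy i, hy' i]
  · have e : ∑ i, (2 * (a * y i + b * y' i) * s i - (s i ^ 2 - c ^ 2) * (a * x i + b * x' i)) =
        a * ∑ i, (2 * y i * s i - (s i ^ 2 - c ^ 2) * x i) +
        b * ∑ i, (2 * y' i * s i - (s i ^ 2 - c ^ 2) * x' i) := by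
      rw [mul_sum, mul_sum, ← sum_add_distrib]
      exact sum_congr rfl fun i _ => by ring
    simp only [Prod.snd_add, Prod.fst_add, Prod.smul_fst, Prod.smul_snd, Pi.add_apply,
      Pi.smul_apply, smul_eq_mul]
    rw [e]
    have h1 := mul_le_mul_of_nonneg_left (h c s hc hs) ha
    have h2 := mul_le_mul_of_nonneg_left (h' c s hc hs) hb
    have : c ^ 2 = a * c ^ 2 + b * c ^ 2 := by rw [← add_mul, hab, one_mul]
    linarith

theorem isClosed_linearHull [Fintype ι] : IsClosed (linearHull (ι := ι)) := by
  unfold linearHull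
  simp only [Set.ofPred_and, Set.ofPred_forall]
  refine .inter ?_ (.inter ?_ ?_)
  · exact isClosed_iInter fun i => (isClosed_le (by fun_prop) (by fun_prop)).inter
      (isClosed_le (by fun_prop) (by fun_prop))
  · exact isClosed_iInter fun i => isClosed_le (by fun_prop) (by fun_prop)
  · exact isClosed_iInter fun c => isClosed_iInter fun s => isClosed_iInter fun _ =>
      isClosed_iInter fun _ => isClosed_le (by fun_prop) (by fun_prop)

theorem mem_convexHull_xPlus_of_mem_cube [Fintype ι] {x y : ι → ℝ} {t : ℝ}
    (hx : ∀ i, x i ∈ Set.Icc (0 : ℝ) 1) (hy : ∀ i, 0 ≤ y i) (hxy : ∀ i, y i ≠ 0 → x i = 1)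
    (ht : (∑ i, y i) ^ 2 ≤ t) : (x, y, t) ∈ convexHull ℝ (XPlus (ι := ι)) := by
  classical
  let V : ι → Set ℝ := fun i => if y i = 0 then {0, 1} else {1}
  have hxV : x ∈ convexHull ℝ (Set.pi Set.univ V) := by
    rw [convexHull_pi]
    intro i _
    by_cases h : y i = 0
    · simpa [V, h, convexHull_pair, segment_eq_Icc] using hx i
    · simp [V, h, hxy i h]
  have hconv : Convex ℝ {z : ι → ℝ | (z, y, t) ∈ convexHull ℝ (XPlus (ι := ι))} := by
    intro z hz z' hz' a b ha hb hab
    have := convex_convexHull ℝ (XPlus (ι := ι)) hz hz' ha hb hab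
    simpa [← add_smul, ← add_mul, hab] using this
  suffices hV : Set.pi Set.univ V ⊆ {z : ι → ℝ | (z, y, t) ∈ XPlus (ι := ι)} from
    convexHull_min (t := {z : ι → ℝ | (z, y, t) ∈ convexHull ℝ (XPlus (ι := ι))})
      (fun z hz => subset_convexHull ℝ XPlus (hV hz)) hconv hxV
  intro z hz
  have hz' : ∀ i, z i ∈ V i := fun i => hz i (Set.mem_univ i)
  refine ⟨fun i => ?_, hy, (sq_nonneg _).trans ht, ht, fun i => ?_⟩
  · have := hz' i
    by_cases h : y i = 0
    · simpa [V, h] using this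
    · right; simpa [V, h] using this
  · have := hz' i
    dsimp only
    by_cases h : y i = 0
    · simp [h]
    · have h1 : z i = 1 := by simpa [V, h] using this
      simp [h1]

theorem conicHull_subset_convexHull [Fintype ι] :
    conicHull (ι := ι) ⊆ convexHull ℝ XPlus := by
  classical
  rintro ⟨x, y, t⟩ ⟨hx, hy, w, τ, hw, hwx, hw1, hτ, hyτ, hτt⟩
  dsimp only at *
  have hw1' : ∀ i, w i ≤ 1 := fun i => (hwx i).trans (hx i).2
  have hwy : ∀ i, w i * (y i / w i) = y i := fun i => mul_div_cancel_of_imp' fun h => by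
    have := hyτ i
    rw [h, mul_zero] at this
    exact pow_eq_zero_iff two_ne_zero |>.1 (le_antisymm this (sq_nonneg _))
  let d : ℝ := t - ∑ i, w i * (y i / w i) ^ 2
  have hd : 0 ≤ d := by
    refine sub_nonneg.2 (le_trans (sum_le_sum fun i _ => ?_) hτt)
    rcases (hw i).eq_or_lt with h | h
    · simpa [← h] using hτ i
    · have : w i * (y i / w i) ^ 2 = y i ^ 2 / w i := by field_simp
      rw [this, div_le_iff₀ h]
      exact hyτ i
  let r : ι → ℝ := fun j => (x j - w j) / (1 - w j)
  have hr : ∀ j, r j ∈ Set.Icc (0 : ℝ) 1 := fun j =>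
    ⟨div_nonneg (sub_nonneg.2 (hwx j)) (sub_nonneg.2 (hw1' j)),
      div_le_one_of_le₀ (by linarith [hx j]) (sub_nonneg.2 (hw1' j))⟩
  have hrx : ∀ j, (1 - w j) * r j = x j - w j := fun j => mul_div_cancel_of_imp' fun h => by
    linarith [hwx j, hx j]
  let W : Option ι → ℝ := fun k => k.elim (1 - ∑ i, w i) w
  let z : Option ι → (ι → ℝ) × (ι → ℝ) × ℝ := fun k =>
    k.elim (r, 0, d) fun i => (Function.update r i 1, Pi.single i (y i / w i), (y i / w i) ^ 2 + d)
  have hz : ∀ k, z k ∈ convexHull ℝ (XPlus (ι := ι)) := by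
    rintro (_ | i)
    · exact mem_convexHull_xPlus_of_mem_cube hr (fun _ => le_rfl) (by simp) (by simpa using hd)
    · refine mem_convexHull_xPlus_of_mem_cube (fun j => ?_) (fun j => ?_) (fun j => ?_) ?_
      · by_cases h : j = i
        · subst h; simp
        · simpa [h] using hr j
      · by_cases h : j = i
        · subst h; simpa using div_nonneg (hy j) (hw j)
        · simp [h]
      · by_cases h : j = i
        · subst h; simp
        · simp [h]
      · simpa using hd
  have hmem := (convex_convexHull ℝ (XPlus (ι := ι))).sum_mem (t := univ) (w := W) (z := z)
    (by
      rintro (_ | i) -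
      · exact sub_nonneg.2 hw1
      · exact hw i)
    (by simp [W, Fintype.sum_option]) fun k _ => hz k
  convert hmem using 1
  rw [Fintype.sum_option]
  refine Prod.ext ?_ (Prod.ext ?_ ?_)
  · ext j
    have h1 : ∀ i, w i * Function.update r i 1 j = w i * r j + if i = j then w j * (1 - r j) else 0 := by
      intro i
      by_cases h : i = j
      · subst h; simp; ring
      · simp [h, Function.update_of_ne (Ne.symm h)]
    simp [W, z, Prod.fst_sum, h1, sum_add_distrib, ← sum_mul]
    linear_combination -hrx j
  · ext j
    have h1 : ∀ i, w i * (Pi.single i (y i / w i) : ι → ℝ) j = if i = j then y j else 0 := by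
      intro i
      by_cases h : i = j
      · subst h; simp [hwy]
      · simp [h]
    simp [W, z, Prod.fst_sum, Prod.snd_sum, h1]
  · simp [W, z, Prod.snd_sum, mul_add, sum_add_distrib, ← sum_mul]
    simp only [d]
    ring

theorem sigmaX_le_of_mem_conicHull [Fintype ι] [DecidableEq ι] {p : (ι → ℝ) × (ι → ℝ) × ℝ}
    (hp : p ∈ conicHull) {L R : Finset ι} (hLR : Disjoint L R) (huniv : L ∪ R = univ) :
    sigmaX L R p.1 p.2.1 ≤ ((p.2.2 : ℝ) : EReal) := by
  obtain ⟨x, y, t⟩ := p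
  obtain ⟨hx, hy, w, τ, hw, hwx, hw1, hτ, hyτ, hτt⟩ := hp
  dsimp only at *
  have hsplit : ∀ f : ι → ℝ, ∑ i, f i = ∑ i ∈ L, f i + ∑ i ∈ R, f i := fun f => by
    rw [← huniv, sum_union hLR]
  rw [hsplit] at hw1 hτt
  have hτL : 0 ≤ ∑ i ∈ L, τ i := sum_nonneg fun i _ => hτ i
  have hwL : 0 ≤ ∑ i ∈ L, w i := sum_nonneg fun i _ => hw i
  have hden : 1 - ∑ i ∈ R, x i + ∑ i ∈ R, (x i - w i) = 1 - ∑ i ∈ R, w i := by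
    rw [sum_sub_distrib]; ring
  unfold sigmaX
  refine (sInf_le (Set.mem_ofPred.2 ⟨fun i => x i - w i, fun i => sub_nonneg.2 (hwx i), ?_,
    fun i _ => sub_le_self _ (hw i), rfl⟩)).trans ?_
  swap
  · rw [hden]; linarith
  · rw [hden]
    have h1 : ratio ((∑ i ∈ L, y i) ^ 2) (1 - ∑ i ∈ R, w i) ≤ ((∑ i ∈ L, τ i : ℝ) : EReal) := by
      refine ratio_le_of_le_mul (sq_nonneg _) (by linarith) hτL ?_
      refine (sum_sq_le_sum_mul_sum_of_sq_le_mul L (fun i _ => hτ i) (fun i _ => hw i)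
        fun i _ => hyτ i).trans ?_
      exact mul_le_mul_of_nonneg_left (by linarith) hτL
    have h2 : ∑ i ∈ R, ratio (y i ^ 2) (x i - (x i - w i)) ≤ ((∑ i ∈ R, τ i : ℝ) : EReal) := by
      rw [ereal_coe_sum]
      refine sum_le_sum fun i _ => ?_
      rw [sub_sub_cancel]
      exact ratio_le_of_le_mul (sq_nonneg _) (hw i) (hτ i) (hyτ i)
    refine (add_le_add h1 h2).trans ?_
    exact_mod_cast hτt

theorem linear_le_sigmaX_univ [Fintype ι] (x y s : ι → ℝ) {c : ℝ} (hc : 0 ≤ c)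
    (hs : ∀ i, c ≤ s i) :
    ((∑ i, (2 * y i * s i - (s i ^ 2 - c ^ 2) * x i) - c ^ 2 : ℝ) : EReal) ≤
      sigmaX ∅ univ x y := by
  refine le_sInf ?_
  rintro _ ⟨mu, hmu, hden, hmux, rfl⟩
  have h1 := tangent_le_ratio (∑ i ∈ (∅ : Finset ι), y i) c hden
  have h2 := sum_le_sum fun i (hi : i ∈ univ) =>
    tangent_le_ratio (y i) (s i) (sub_nonneg.2 (hmux i hi))
  rw [← ereal_coe_sum] at h2
  refine le_trans ?_ (add_le_add h1 h2)
  rw [← EReal.coe_add, EReal.coe_le_coe_iff]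
  have key : ∀ i, 2 * y i * s i - (s i ^ 2 - c ^ 2) * x i ≤
      (2 * y i * s i - s i ^ 2 * (x i - mu i)) + c ^ 2 * (x i - mu i) := by
    intro i
    have h3 : 0 ≤ s i ^ 2 - c ^ 2 := by nlinarith [hs i]
    nlinarith [mul_nonneg h3 (hmu i)]
  have hsum := sum_le_sum fun i (_ : i ∈ univ) => key i
  rw [sum_add_distrib, ← mul_sum, sum_sub_distrib (f := x)] at hsum
  simp only [sum_empty]
  linarith

/-- The closed convex hull of `X₊` equals the set of
`(x,y,t) ∈ [0,1]^N × ℝ₊^N × ℝ` satisfying `σ_{L,R}(x,y) ≤ t` for every partition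
`(L,R)` of `N`. -/
theorem stmt_19 {ι : Type*} [Fintype ι] [DecidableEq ι] :
    closure (convexHull ℝ (XPlus (ι := ι))) =
      {p : (ι → ℝ) × (ι → ℝ) × ℝ |
        (∀ i, 0 ≤ p.1 i ∧ p.1 i ≤ 1) ∧ (∀ i, 0 ≤ p.2.1 i) ∧
        ∀ L R : Finset ι, Disjoint L R → L ∪ R = Finset.univ →
          sigmaX L R p.1 p.2.1 ≤ ((p.2.2 : ℝ) : EReal)} := by
  refine Set.Subset.antisymm ?_ ?_
  · have hsub : closure (convexHull ℝ (XPlus (ι := ι))) ⊆ linearHull :=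
      closure_minimal (convexHull_min
        (xPlus_subset_conicHull.trans conicHull_subset_linearHull) convex_linearHull)
        isClosed_linearHull
    intro p hp
    have hp' := linearHull_subset_conicHull (hsub hp)
    exact ⟨hp'.1, hp'.2.1, fun L R hLR huniv => sigmaX_le_of_mem_conicHull hp' hLR huniv⟩
  · rintro p ⟨hx, hy, hσ⟩
    refine subset_closure (conicHull_subset_convexHull (linearHull_subset_conicHull
      ⟨hx, hy, fun c s hc hs => ?_⟩))
    exact EReal.coe_le_coe_iff.1 ((linear_le_sigmaX_univ p.1 p.2.1 s hc hs).trans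
      (hσ ∅ univ (disjoint_empty_left _) (empty_union _)))

end
end
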